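/- Let n ≥ 1, let 0 ≤ k ≤ n, and let A ⊆ {0,1}^n be a set of 0–1 vectors each of weight exactly k (i.e., with exactly k coordinates equal to 1). If A is sunflower-free, then |A| · 2^{n−k} ≤ C_n, where C_n is the size of the largest capset in (ℤ/3ℤ)^n. -/

import Mathlib

/-- The weight of a 0–1 vector: the number of coordinates equal to 1. -/
def weight {n : ℕ} (x : Fin n → Bool) : ℕ :=
  (Finset.univ.filter fun i => x i = true).card

/-- `A ⊆ {0,1}^n` is sunflower-free: it contains no three elements, not all equal,
such that in every coordinate the multiset of values is `{0,0,0}`, `{1,1,1}` or `{0,0,1}`. -/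
def SunflowerFree {n : ℕ} (A : Finset (Fin n → Bool)) : Prop :=
  ¬ ∃ x ∈ A, ∃ y ∈ A, ∃ z ∈ A, ¬ (x = y ∧ y = z) ∧
    ∀ i, ({x i, y i, z i} : Multiset Bool) = {false, false, false} ∨
         ({x i, y i, z i} : Multiset Bool) = {true, true, true} ∨
         ({x i, y i, z i} : Multiset Bool) = {false, false, true}

/-- A capset in `(ZMod 3)^n`: no three elements, not all equal, summing to zero. -/
def IsCapset {n : ℕ} (S : Finset (Fin n → ZMod 3)) : Prop :=
  ∀ x ∈ S, ∀ y ∈ S, ∀ z ∈ S, x + y + z = 0 → x = y ∧ y = z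

/-- `C_n`, the size of the largest capset in `(ZMod 3)^n`. -/
noncomputable def capsetMax (n : ℕ) : ℕ :=
  sSup {k | ∃ S : Finset (Fin n → ZMod 3), IsCapset S ∧ S.card = k}

lemma IsCapset.card_le_capsetMax {n : ℕ} {S : Finset (Fin n → ZMod 3)} (hS : IsCapset S) :
    S.card ≤ capsetMax n := by
  refine le_csSup ⟨Fintype.card (Fin n → ZMod 3), ?_⟩ ⟨S, hS, rfl⟩
  rintro _ ⟨T, -, rfl⟩
  exact T.card_le_univ

/-- The 0–1 indicator vector of the zero coordinates of `v`. -/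
def zeroPattern {n : ℕ} (v : Fin n → ZMod 3) : Fin n → Bool := fun i => decide (v i = 0)

/-- The vectors of `(ZMod 3)^n` whose zero pattern lies in `A`. -/
def zeroPatternPreimage {n : ℕ} (A : Finset (Fin n → Bool)) : Finset (Fin n → ZMod 3) :=
  Finset.univ.filter fun v => zeroPattern v ∈ A

lemma SunflowerFree.isCapset_zeroPatternPreimage {n : ℕ} {A : Finset (Fin n → Bool)}
    (hA : SunflowerFree A) : IsCapset (zeroPatternPreimage A) := by
  intro x hx y hy z hz h
  simp only [zeroPatternPreimage, Finset.mem_filter, Finset.mem_univ, true_and] at hx hy hz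
  have hsunflower : ∀ a b c : ZMod 3, a + b + c = 0 →
      ({decide (a = 0), decide (b = 0), decide (c = 0)} : Multiset Bool) = {false, false, false} ∨
      ({decide (a = 0), decide (b = 0), decide (c = 0)} : Multiset Bool) = {true, true, true} ∨
      ({decide (a = 0), decide (b = 0), decide (c = 0)} : Multiset Bool) = {false, false, true} := by
    decide
  have heq : ∀ a b c : ZMod 3, a + b + c = 0 → decide (a = 0) = decide (b = 0) →
      decide (b = 0) = decide (c = 0) → a = b ∧ b = c := by
    decide
  obtain ⟨hxy, hyz⟩ : zeroPattern x = zeroPattern y ∧ zeroPattern y = zeroPattern z := by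
    by_contra hne
    exact hA ⟨_, hx, _, hy, _, hz, hne, fun i => hsunflower _ _ _ (congrFun h i)⟩
  have hi i := heq _ _ _ (congrFun h i) (congrFun hxy i) (congrFun hyz i)
  exact ⟨funext fun i => (hi i).1, funext fun i => (hi i).2⟩

lemma card_filter_zeroPattern_eq {n : ℕ} (x : Fin n → Bool) :
    (Finset.univ.filter fun v : Fin n → ZMod 3 => zeroPattern v = x).card =
      2 ^ (n - weight x) := by
  have hfiber : (Finset.univ.filter fun v : Fin n → ZMod 3 => zeroPattern v = x) =
      Fintype.piFinset fun i => Finset.univ.filter fun a : ZMod 3 => decide (a = 0) = x i := by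
    ext v
    simp [zeroPattern, funext_iff]
  have hcard : ∀ b : Bool, (Finset.univ.filter fun a : ZMod 3 => decide (a = 0) = b).card =
      if b = true then 1 else 2 := by
    decide
  have hadd := Finset.card_filter_add_card_filter_not (s := Finset.univ) fun i => x i = true
  rw [Finset.card_univ, Fintype.card_fin] at hadd
  simp_rw [hfiber, Fintype.card_piFinset, hcard, Finset.prod_ite, Finset.prod_const, one_pow,
    one_mul]
  congr 1
  unfold weight
  omega

theorem sunflowerFree_fixed_weight_bound {n k : ℕ} (hn : 1 ≤ n) (hk : k ≤ n)
    (A : Finset (Fin n → Bool)) (hw : ∀ x ∈ A, weight x = k)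
    (hA : SunflowerFree A) :
    A.card * 2 ^ (n - k) ≤ capsetMax n := by
  refine le_of_eq_of_le ?_ hA.isCapset_zeroPatternPreimage.card_le_capsetMax
  rw [Finset.card_eq_sum_card_fiberwise (s := zeroPatternPreimage A) (f := zeroPattern) (t := A)
    fun v hv => (Finset.mem_filter.mp hv).2, ← smul_eq_mul, ← Finset.sum_const]
  refine Finset.sum_congr rfl fun x hx => ?_
  rw [← hw x hx, ← card_filter_zeroPattern_eq, zeroPatternPreimage, Finset.filter_filter]
  congr 1
  ext v
  simp only [Finset.mem_filter, Finset.mem_univ, true_and]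
  exact ⟨fun h => ⟨h ▸ hx, h⟩, fun h => h.2⟩
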